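/- Let Θ = {θ_{x,t} = M_{x,t}(𝔹ⁿ) + x} be a continuous ellipsoid cover of ℝⁿ. Then there exists a continuous ellipsoid cover Ξ = {ξ_{x,t} = N_{x,t}(𝔹ⁿ) + x} of ℝⁿ (with possibly different parameters) which is pointwise continuous, i.e., for every t ∈ ℝ the matrix-valued map x ↦ N_{x,t} is continuous, and which is equivalent to Θ: there exists a constant C > 0 such that (1/C)ξ_{x,t} ⊆ θ_{x,t} ⊆ C ξ_{x,t} for all x ∈ ℝⁿ and t ∈ ℝ, where λξ denotes the dilate λN_{x,t}(𝔹ⁿ) + x of the ellipsoid ξ = N_{x,t}(𝔹ⁿ) + x about its center. -/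

import Mathlib

open MeasureTheory Metric Set Filter ENNReal
noncomputable section

abbrev Euc (n : ℕ) : Type := EuclideanSpace ℝ (Fin n)

structure EllipsoidCover (n : ℕ) where
  M : Euc n → ℝ → (Euc n ≃L[ℝ] Euc n)
  a₁ : ℝ
  a₂ : ℝ
  a₃ : ℝ
  a₄ : ℝ
  a₅ : ℝ
  a₆ : ℝ
  ha₁ : 0 < a₁
  ha₂ : 0 < a₂
  ha₃ : 0 < a₃
  ha₄ : 0 < a₄
  ha₅ : 0 < a₅
  ha₆ : 0 < a₆
  volume_lb : ∀ (x : Euc n) (t : ℝ),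
    a₁ * 2 ^ (-t) ≤ (volume ((fun y => M x t y + x) '' ball 0 1)).toReal
  volume_ub : ∀ (x : Euc n) (t : ℝ),
    (volume ((fun y => M x t y + x) '' ball 0 1)).toReal ≤ a₂ * 2 ^ (-t)
  shape : ∀ (x y : Euc n) (t s : ℝ), 0 ≤ s →
    (((fun v => M x t v + x) '' ball 0 1) ∩ ((fun v => M y (t + s) v + y) '' ball 0 1)).Nonempty →
    a₃ * 2 ^ (-(a₄ * s)) ≤
        1 / ‖((M y (t + s)).symm : Euc n →L[ℝ] Euc n).comp (M x t : Euc n →L[ℝ] Euc n)‖ ∧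
    1 / ‖((M y (t + s)).symm : Euc n →L[ℝ] Euc n).comp (M x t : Euc n →L[ℝ] Euc n)‖ ≤
        ‖((M x t).symm : Euc n →L[ℝ] Euc n).comp (M y (t + s) : Euc n →L[ℝ] Euc n)‖ ∧
    ‖((M x t).symm : Euc n →L[ℝ] Euc n).comp (M y (t + s) : Euc n →L[ℝ] Euc n)‖ ≤
        a₅ * 2 ^ (-(a₆ * s))

namespace EllipsoidCover

variable {n : ℕ}

def θ (Θ : EllipsoidCover n) (x : Euc n) (t : ℝ) : Set (Euc n) :=
  (fun y => Θ.M x t y + x) '' ball 0 1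

def dil (Θ : EllipsoidCover n) (x : Euc n) (t : ℝ) (lam : ℝ) : Set (Euc n) :=
  (fun y => lam • (Θ.M x t y) + x) '' ball 0 1

def ρ (Θ : EllipsoidCover n) (x y : Euc n) : ℝ :=
  sInf {r : ℝ | ∃ (z : Euc n) (t : ℝ), x ∈ Θ.θ z t ∧ y ∈ Θ.θ z t ∧ r = (volume (Θ.θ z t)).toReal}

end EllipsoidCover

open scoped MatrixOrder Matrix.Norms.L2Operator in
/-- A continuous family of positive operators on Euclidean space has a continuous family of
self-adjoint square roots. -/
theorem exists_continuous_selfAdjoint_sqrt {X : Type*} [TopologicalSpace X] {n : ℕ}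
    {P : X → (Euc n →L[ℝ] Euc n)} (hP : Continuous P) (hpos : ∀ x, (P x).IsPositive) :
    ∃ S : X → (Euc n →L[ℝ] Euc n), Continuous S ∧
      ∀ x, IsSelfAdjoint (S x) ∧ S x * S x = P x := by
  let e := Matrix.toEuclideanCLM (n := Fin n) (𝕜 := ℝ)
  have he : Continuous e := e.toAlgEquiv.toLinearMap.continuous_of_finiteDimensional
  have he' : Continuous e.symm := e.symm.toAlgEquiv.toLinearMap.continuous_of_finiteDimensional
  have hnn : ∀ x, 0 ≤ e.symm (P x) := by
    intro x
    rw [Matrix.nonneg_iff_posSemidef, ← Matrix.isPositive_toEuclideanLin_iff]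
    have h : Matrix.toEuclideanLin (e.symm (P x)) = (P x : Euc n →ₗ[ℝ] Euc n) :=
      congrArg ContinuousLinearMap.toLinearMap (e.apply_symm_apply (P x))
    rw [h]
    exact (hpos x).toLinearMap
  refine ⟨fun x => e (CFC.sqrt (e.symm (P x))), ?_, fun x => ⟨?_, ?_⟩⟩
  · exact he.comp (CFC.continuousOn_sqrt.comp_continuous (he'.comp hP) hnn)
  · exact ((CFC.sqrt_nonneg _).isSelfAdjoint).map e
  · rw [← map_mul, CFC.sqrt_mul_sqrt_self _ (hnn x), StarAlgEquiv.apply_symm_apply]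

namespace EllipsoidCover

variable {n : ℕ}

theorem norm_symm_comp_le_of_mem (Θ : EllipsoidCover n) {x y : Euc n} {t : ℝ}
    (h : y ∈ Θ.θ x t) :
    ‖((Θ.M x t).symm : Euc n →L[ℝ] Euc n).comp (Θ.M y t : Euc n →L[ℝ] Euc n)‖ ≤ Θ.a₅ ∧
    ‖((Θ.M y t).symm : Euc n →L[ℝ] Euc n).comp (Θ.M x t : Euc n →L[ℝ] Euc n)‖ ≤ Θ.a₅ := by
  have hy : y ∈ Θ.θ y t := ⟨0, by simp, by simp⟩
  have h1 := (Θ.shape x y t 0 le_rfl (by rw [add_zero]; exact ⟨y, h, hy⟩)).2.2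
  have h2 := (Θ.shape y x t 0 le_rfl (by rw [add_zero]; exact ⟨y, hy, h⟩)).2.2
  simp only [add_zero, mul_zero, neg_zero, Real.rpow_zero, mul_one] at h1 h2
  exact ⟨h1, h2⟩

/-- If `‖A⁻¹ B‖ ≤ c`, then the adjoints satisfy `‖B† v‖ ≤ c ‖A† v‖`. -/
theorem norm_adjoint_apply_le {A B : Euc n ≃L[ℝ] Euc n} {c : ℝ}
    (h : ‖(A.symm : Euc n →L[ℝ] Euc n).comp (B : Euc n →L[ℝ] Euc n)‖ ≤ c) (v : Euc n) :
    ‖ContinuousLinearMap.adjoint (B : Euc n →L[ℝ] Euc n) v‖ ≤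
      c * ‖ContinuousLinearMap.adjoint (A : Euc n →L[ℝ] Euc n) v‖ := by
  have hB : (B : Euc n →L[ℝ] Euc n) = (A : Euc n →L[ℝ] Euc n).comp
      ((A.symm : Euc n →L[ℝ] Euc n).comp (B : Euc n →L[ℝ] Euc n)) := by
    ext1 w; simp
  rw [hB, ContinuousLinearMap.adjoint_comp]
  rw [← LinearIsometryEquiv.norm_map ContinuousLinearMap.adjoint] at h
  exact ContinuousLinearMap.le_of_opNorm_le _ h
    (ContinuousLinearMap.adjoint (A : Euc n →L[ℝ] Euc n) v)

/-- If `‖B† v‖ ≤ c ‖A† v‖` for all `v`, then `‖A⁻¹ B‖ ≤ c`. -/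
theorem norm_symm_comp_le {A B : Euc n ≃L[ℝ] Euc n} {c : ℝ} (hc : 0 ≤ c)
    (h : ∀ v, ‖ContinuousLinearMap.adjoint (B : Euc n →L[ℝ] Euc n) v‖ ≤
      c * ‖ContinuousLinearMap.adjoint (A : Euc n →L[ℝ] Euc n) v‖) :
    ‖(A.symm : Euc n →L[ℝ] Euc n).comp (B : Euc n →L[ℝ] Euc n)‖ ≤ c := by
  rw [← LinearIsometryEquiv.norm_map ContinuousLinearMap.adjoint,
    ContinuousLinearMap.adjoint_comp]
  refine ContinuousLinearMap.opNorm_le_bound _ hc fun v => ?_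
  refine (h _).trans_eq ?_
  have hA : (ContinuousLinearMap.adjoint (A : Euc n →L[ℝ] Euc n)).comp
      (ContinuousLinearMap.adjoint (A.symm : Euc n →L[ℝ] Euc n)) =
      ContinuousLinearMap.id ℝ (Euc n) := by
    rw [← ContinuousLinearMap.adjoint_comp, ContinuousLinearEquiv.coe_symm_comp_coe,
      ContinuousLinearMap.adjoint_id]
  exact congrArg (fun w => c * ‖w‖) (DFunLike.congr_fun hA v)

/-- A continuous convex selection of positive operators comparable with `M M†`. -/
theorem exists_continuous_comparable_form (Θ : EllipsoidCover n) (t : ℝ) :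
    ∃ P : Euc n → (Euc n →L[ℝ] Euc n), Continuous P ∧ ∀ x, IsSelfAdjoint (P x) ∧
      ∀ v, inner ℝ (P x v) v ≤
          ‖ContinuousLinearMap.adjoint (Θ.M x t : Euc n →L[ℝ] Euc n) v‖ ^ 2 ∧
        ‖ContinuousLinearMap.adjoint (Θ.M x t : Euc n →L[ℝ] Euc n) v‖ ^ 2 ≤
          (Θ.a₅ ^ 2) ^ 2 * inner ℝ (P x v) v := by
  have ha := Θ.ha₅
  let F : Euc n → Set (Euc n →L[ℝ] Euc n) := fun x => {P | IsSelfAdjoint P ∧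
    ∀ v, inner ℝ (P v) v ≤
        ‖ContinuousLinearMap.adjoint (Θ.M x t : Euc n →L[ℝ] Euc n) v‖ ^ 2 ∧
      ‖ContinuousLinearMap.adjoint (Θ.M x t : Euc n →L[ℝ] Euc n) v‖ ^ 2 ≤
        (Θ.a₅ ^ 2) ^ 2 * inner ℝ (P v) v}
  suffices h : ∃ P : C(Euc n, Euc n →L[ℝ] Euc n), ∀ x, P x ∈ F x from
    let ⟨P, hP⟩ := h
    ⟨P, P.continuous, hP⟩
  refine exists_continuous_forall_mem_convex_of_local_const ?_ ?_
  · rintro x P ⟨hP, hP'⟩ Q ⟨hQ, hQ'⟩ a b h0a h0b hab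
    refine ⟨IsSelfAdjoint.add (R := Euc n →L[ℝ] Euc n) ((IsSelfAdjoint.all a).smul hP)
      ((IsSelfAdjoint.all b).smul hQ), fun v => ?_⟩
    obtain ⟨h1, h2⟩ := hP' v
    obtain ⟨h3, h4⟩ := hQ' v
    obtain rfl : b = 1 - a := by linarith
    simp only [add_apply, smul_apply, inner_add_left,
      real_inner_smul_left]
    constructor
    · linarith [mul_le_mul_of_nonneg_left h1 h0a, mul_le_mul_of_nonneg_left h3 h0b]
    · linarith [mul_le_mul_of_nonneg_left h2 h0a, mul_le_mul_of_nonneg_left h4 h0b]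
  · intro x
    refine ⟨(Θ.a₅ ^ 2)⁻¹ • ((Θ.M x t : Euc n →L[ℝ] Euc n).comp
      (ContinuousLinearMap.adjoint (Θ.M x t : Euc n →L[ℝ] Euc n))), ?_⟩
    have hopen : IsOpen (Θ.θ x t) := by
      have h : Θ.θ x t = ((Θ.M x t).toHomeomorph.trans (Homeomorph.addRight x)) '' ball 0 1 := rfl
      rw [h]
      exact ((Θ.M x t).toHomeomorph.trans (Homeomorph.addRight x)).isOpenMap _ isOpen_ball
    filter_upwards [hopen.mem_nhds ⟨0, by simp, by simp⟩] with y hy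
    obtain ⟨h1, h2⟩ := Θ.norm_symm_comp_le_of_mem hy
    refine ⟨(IsSelfAdjoint.all (Θ.a₅ ^ 2)⁻¹).smul
      (IsSelfAdjoint.mul_star_self (Θ.M x t : Euc n →L[ℝ] Euc n)), fun v => ?_⟩
    have hq : inner ℝ (((Θ.a₅ ^ 2)⁻¹ • ((Θ.M x t : Euc n →L[ℝ] Euc n).comp
        (ContinuousLinearMap.adjoint (Θ.M x t : Euc n →L[ℝ] Euc n)))) v) v =
        (Θ.a₅ ^ 2)⁻¹ *
          ‖ContinuousLinearMap.adjoint (Θ.M x t : Euc n →L[ℝ] Euc n) v‖ ^ 2 := by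
      rw [smul_apply, real_inner_smul_left, ContinuousLinearMap.comp_apply,
        ← ContinuousLinearMap.adjoint_inner_right, real_inner_self_eq_norm_sq]
    have h3 := pow_le_pow_left₀ (norm_nonneg _) (norm_adjoint_apply_le h1 v) 2
    have h4 := pow_le_pow_left₀ (norm_nonneg _) (norm_adjoint_apply_le h2 v) 2
    rw [mul_pow] at h3 h4
    rw [hq]
    constructor
    · rwa [inv_mul_le_iff₀ (by positivity)]
    · refine h3.trans_eq ?_
      field_simp

/-- Pointwise continuous frames comparable with those of `Θ`. -/
theorem exists_continuous_comparable (Θ : EllipsoidCover n) :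
    ∃ N : Euc n → ℝ → (Euc n ≃L[ℝ] Euc n),
      (∀ t, Continuous fun x => (N x t : Euc n →L[ℝ] Euc n)) ∧ ∀ x t,
        ‖((Θ.M x t).symm : Euc n →L[ℝ] Euc n).comp (N x t : Euc n →L[ℝ] Euc n)‖ ≤ 1 ∧
        ‖((N x t).symm : Euc n →L[ℝ] Euc n).comp (Θ.M x t : Euc n →L[ℝ] Euc n)‖ ≤
          Θ.a₅ ^ 2 := by
  choose P hPc hP using Θ.exists_continuous_comparable_form
  have hpos : ∀ t x, (P t x).IsPositive := by
    intro t x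
    have h := (hP t x).2
    refine ContinuousLinearMap.isPositive_iff' _ |>.2 ⟨(hP t x).1, fun v => ?_⟩
    have ha : 0 < (Θ.a₅ ^ 2) ^ 2 := by have := Θ.ha₅; positivity
    exact (mul_nonneg_iff_of_pos_left ha).1 ((sq_nonneg _).trans (h v).2)
  choose S hSc hS using fun t => exists_continuous_selfAdjoint_sqrt (hPc t) (hpos t)
  have hnorm : ∀ t x v, ‖S t x v‖ ^ 2 = inner ℝ (P t x v) v := by
    intro t x v
    rw [← (hS t x).2, mul_apply_eq_comp, ← real_inner_self_eq_norm_sq]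
    exact ((hS t x).1.isSymmetric (S t x v) v).symm
  have hle : ∀ t x v, ‖S t x v‖ ≤
      ‖ContinuousLinearMap.adjoint (Θ.M x t : Euc n →L[ℝ] Euc n) v‖ := by
    intro t x v
    refine le_of_sq_le_sq ?_ (norm_nonneg _)
    rw [hnorm]
    exact ((hP t x).2 v).1
  have hge : ∀ t x v, ‖ContinuousLinearMap.adjoint (Θ.M x t : Euc n →L[ℝ] Euc n) v‖ ≤
      Θ.a₅ ^ 2 * ‖S t x v‖ := by
    intro t x v
    refine le_of_sq_le_sq ?_ (by positivity)
    rw [mul_pow, hnorm]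
    exact ((hP t x).2 v).2
  have hinj : ∀ t x, Function.Injective (S t x : Euc n →ₗ[ℝ] Euc n) := by
    intro t x
    rw [← LinearMap.ker_eq_bot, LinearMap.ker_eq_bot']
    intro v hv
    have h0 : ContinuousLinearMap.adjoint (Θ.M x t : Euc n →L[ℝ] Euc n) v = 0 := by
      have h := hge t x v
      rw [show S t x v = 0 from hv, norm_zero, mul_zero] at h
      exact norm_le_zero_iff.1 h
    have h1 : inner ℝ ((Θ.M x t) ((Θ.M x t).symm v)) v = 0 := by
      have h := ContinuousLinearMap.adjoint_inner_right (Θ.M x t : Euc n →L[ℝ] Euc n)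
        ((Θ.M x t).symm v) v
      rw [h0, inner_zero_right] at h
      exact h.symm
    rw [ContinuousLinearEquiv.apply_symm_apply] at h1
    exact inner_self_eq_zero.1 h1
  let N : Euc n → ℝ → (Euc n ≃L[ℝ] Euc n) := fun x t =>
    (LinearEquiv.ofInjectiveEndo _ (hinj t x)).toContinuousLinearEquiv
  have hN : ∀ x t, (N x t : Euc n →L[ℝ] Euc n) = S t x := fun x t => by ext1 v; rfl
  have hadj : ∀ x t, ContinuousLinearMap.adjoint (N x t : Euc n →L[ℝ] Euc n) = S t x :=
    fun x t => by rw [hN]; exact (hS t x).1.adjoint_eq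
  refine ⟨N, fun t => by simpa only [hN] using hSc t, fun x t => ⟨?_, ?_⟩⟩
  · refine norm_symm_comp_le zero_le_one fun v => ?_
    rw [hadj, one_mul]
    exact hle t x v
  · refine norm_symm_comp_le (by positivity) fun v => ?_
    rw [hadj]
    exact hge t x v

/-- If `‖A⁻¹ B‖ ≤ 1`, then the ellipsoid of `B` is contained in that of `A`. -/
theorem image_ball_subset {A B : Euc n ≃L[ℝ] Euc n}
    (h : ‖(A.symm : Euc n →L[ℝ] Euc n).comp (B : Euc n →L[ℝ] Euc n)‖ ≤ 1) (x : Euc n) :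
    (fun v => B v + x) '' ball 0 1 ⊆ (fun v => A v + x) '' ball 0 1 := by
  rintro _ ⟨v, hv, rfl⟩
  refine ⟨A.symm (B v), ?_, by simp⟩
  rw [mem_ball_zero_iff] at hv ⊢
  have h1 := ((A.symm : Euc n →L[ℝ] Euc n).comp (B : Euc n →L[ℝ] Euc n)).le_of_opNorm_le h v
  simp only [ContinuousLinearMap.comp_apply, ContinuousLinearEquiv.coe_coe] at h1
  linarith

/-- If `‖B⁻¹ A‖ ≤ C`, then the ellipsoid of `A` is contained in the `C`-dilate of that of `B`. -/
theorem image_ball_subset_dilate {A B : Euc n ≃L[ℝ] Euc n} {C : ℝ} (hC : 0 < C)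
    (h : ‖(B.symm : Euc n →L[ℝ] Euc n).comp (A : Euc n →L[ℝ] Euc n)‖ ≤ C) (x : Euc n) :
    (fun v => A v + x) '' ball 0 1 ⊆ (fun v => C • B v + x) '' ball 0 1 := by
  rintro _ ⟨v, hv, rfl⟩
  refine ⟨C⁻¹ • B.symm (A v), ?_, ?_⟩
  · rw [mem_ball_zero_iff] at hv ⊢
    have h1 := ((B.symm : Euc n →L[ℝ] Euc n).comp (A : Euc n →L[ℝ] Euc n)).le_of_opNorm_le h v
    simp only [ContinuousLinearMap.comp_apply, ContinuousLinearEquiv.coe_coe] at h1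
    rw [norm_smul, norm_inv, Real.norm_of_nonneg hC.le, inv_mul_lt_iff₀ hC]
    calc _ ≤ C * ‖v‖ := h1
      _ < C * 1 := by gcongr
  · simp [hC.ne']

theorem volume_image_ball_ne_top (A : Euc n ≃L[ℝ] Euc n) (x : Euc n) :
    volume ((fun v => A v + x) '' ball 0 1) ≠ ∞ := by
  have h : (fun v => A v + x) '' ball 0 1 ⊆ (fun v => A v + x) '' closedBall 0 1 :=
    image_mono ball_subset_closedBall
  exact ((measure_mono h).trans_lt
    ((isCompact_closedBall 0 1).image (by fun_prop)).measure_lt_top).ne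

theorem volume_dilate (A : Euc n ≃L[ℝ] Euc n) (x : Euc n) {C : ℝ} (hC : 0 < C) :
    (volume ((fun v => C • A v + x) '' ball 0 1)).toReal =
      C ^ n * (volume ((fun v => A v + x) '' ball 0 1)).toReal := by
  have h : (fun v => C • A v + x) '' ball 0 1 =
      AffineMap.homothety x C '' ((fun v => A v + x) '' ball 0 1) := by
    rw [image_image]
    exact image_congr fun v _ => by simp [AffineMap.homothety_apply]
  rw [h, Measure.addHaar_image_homothety, ENNReal.toReal_mul, ENNReal.toReal_ofReal (abs_nonneg _),
    finrank_euclideanSpace_fin, abs_of_pos (by positivity)]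

/-- Frames comparable with those of a cover, with ellipsoids contained in those of the cover,
again form a cover. -/
theorem exists_cover_of_comparable [Nontrivial (Euc n)] (Θ : EllipsoidCover n)
    (N : Euc n → ℝ → (Euc n ≃L[ℝ] Euc n)) {C : ℝ} (hC : 0 < C)
    (hMN : ∀ x t, ‖((Θ.M x t).symm : Euc n →L[ℝ] Euc n).comp (N x t : Euc n →L[ℝ] Euc n)‖ ≤ 1)
    (hNM : ∀ x t, ‖((N x t).symm : Euc n →L[ℝ] Euc n).comp (Θ.M x t : Euc n →L[ℝ] Euc n)‖ ≤ C) :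
    ∃ Ξ : EllipsoidCover n, Ξ.M = N := by
  have hcomp : ∀ x y t u,
      ‖((N x t).symm : Euc n →L[ℝ] Euc n).comp (N y u : Euc n →L[ℝ] Euc n)‖ ≤
        C * ‖((Θ.M x t).symm : Euc n →L[ℝ] Euc n).comp (Θ.M y u : Euc n →L[ℝ] Euc n)‖ := by
    intro x y t u
    have h : ((N x t).symm : Euc n →L[ℝ] Euc n).comp (N y u : Euc n →L[ℝ] Euc n) =
        (((N x t).symm : Euc n →L[ℝ] Euc n).comp (Θ.M x t : Euc n →L[ℝ] Euc n)).comp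
        ((((Θ.M x t).symm : Euc n →L[ℝ] Euc n).comp (Θ.M y u : Euc n →L[ℝ] Euc n)).comp
        (((Θ.M y u).symm : Euc n →L[ℝ] Euc n).comp (N y u : Euc n →L[ℝ] Euc n))) := by
      ext1 v; simp
    rw [h]
    refine (ContinuousLinearMap.opNorm_comp_le _ _).trans ?_
    gcongr
    · exact hNM x t
    · refine (ContinuousLinearMap.opNorm_comp_le _ _).trans ?_
      exact mul_le_of_le_one_right (norm_nonneg _) (hMN y u)
  have hpos : ∀ x y t u,
      0 < ‖((N x t).symm : Euc n →L[ℝ] Euc n).comp (N y u : Euc n →L[ℝ] Euc n)‖ := by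
    intro x y t u
    exact ((N y u).trans (N x t).symm).norm_pos
  have hone : ∀ x y t u, 1 ≤
      ‖((N x t).symm : Euc n →L[ℝ] Euc n).comp (N y u : Euc n →L[ℝ] Euc n)‖ *
      ‖((N y u).symm : Euc n →L[ℝ] Euc n).comp (N x t : Euc n →L[ℝ] Euc n)‖ := by
    intro x y t u
    have h : (((N x t).symm : Euc n →L[ℝ] Euc n).comp (N y u : Euc n →L[ℝ] Euc n)).comp
        (((N y u).symm : Euc n →L[ℝ] Euc n).comp (N x t : Euc n →L[ℝ] Euc n)) =
        ContinuousLinearMap.id ℝ (Euc n) := by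
      ext1 v; simp
    have h1 := ContinuousLinearMap.opNorm_comp_le
      (((N x t).symm : Euc n →L[ℝ] Euc n).comp (N y u : Euc n →L[ℝ] Euc n))
      (((N y u).symm : Euc n →L[ℝ] Euc n).comp (N x t : Euc n →L[ℝ] Euc n))
    rwa [h, ContinuousLinearMap.norm_id] at h1
  have ha₁ := Θ.ha₁
  have ha₃ := Θ.ha₃
  have ha₅ := Θ.ha₅
  refine ⟨{ M := N
            a₁ := Θ.a₁ / C ^ n
            a₂ := Θ.a₂
            a₃ := Θ.a₃ / C
            a₄ := Θ.a₄
            a₅ := C * Θ.a₅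
            a₆ := Θ.a₆
            ha₁ := by positivity
            ha₂ := Θ.ha₂
            ha₃ := by positivity
            ha₄ := Θ.ha₄
            ha₅ := by positivity
            ha₆ := Θ.ha₆
            volume_lb := fun x t => ?_
            volume_ub := fun x t => ?_
            shape := fun x y t s hs hne => ?_ }, rfl⟩
  · have h1 := ENNReal.toReal_mono (b := volume ((fun v => C • N x t v + x) '' ball 0 1)) ?_
      (measure_mono (image_ball_subset_dilate hC (hNM x t) x))
    · rw [volume_dilate _ _ hC] at h1
      rw [div_mul_eq_mul_div, div_le_iff₀' (by positivity)]
      exact (Θ.volume_lb x t).trans h1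
    · have h2 := volume_image_ball_ne_top
        ((N x t).trans (ContinuousLinearEquiv.smulLeft (Units.mk0 C hC.ne'))) x
      exact h2
  · exact (ENNReal.toReal_mono (volume_image_ball_ne_top _ _)
      (measure_mono (image_ball_subset (hMN x t) x))).trans (Θ.volume_ub x t)
  · obtain ⟨h1, -, h3⟩ := Θ.shape x y t s hs (hne.mono (inter_subset_inter
      (image_ball_subset (hMN x t) x) (image_ball_subset (hMN y (t + s)) y)))
    refine ⟨?_, ?_, ?_⟩
    · calc Θ.a₃ / C * 2 ^ (-(Θ.a₄ * s)) = C⁻¹ * (Θ.a₃ * 2 ^ (-(Θ.a₄ * s))) := by ring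
        _ ≤ C⁻¹ * (1 / ‖((Θ.M y (t + s)).symm : Euc n →L[ℝ] Euc n).comp
            (Θ.M x t : Euc n →L[ℝ] Euc n)‖) := by gcongr
        _ = 1 / (C * ‖((Θ.M y (t + s)).symm : Euc n →L[ℝ] Euc n).comp
            (Θ.M x t : Euc n →L[ℝ] Euc n)‖) := by ring
        _ ≤ _ := one_div_le_one_div_of_le (hpos _ _ _ _) (hcomp _ _ _ _)
    · rw [div_le_iff₀ (hpos _ _ _ _)]
      exact hone _ _ _ _
    · rw [mul_assoc]
      exact (hcomp _ _ _ _).trans (by gcongr)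

theorem nontrivial_space (Θ : EllipsoidCover n) : Nontrivial (Euc n) := by
  by_contra h
  rw [not_nontrivial_iff_subsingleton] at h
  have h1 := (Θ.shape 0 0 0 0 le_rfl
    ⟨0, ⟨0, by simp, by simp⟩, ⟨0, by simp, by simp⟩⟩).1
  rw [Subsingleton.elim (((Θ.M 0 (0 + 0)).symm : Euc n →L[ℝ] Euc n).comp
    (Θ.M 0 0 : Euc n →L[ℝ] Euc n)) 0] at h1
  have h2 := Θ.ha₃
  simp at h1
  linarith

end EllipsoidCover

/-- Every continuous ellipsoid cover `Θ` admits an equivalent pointwise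
continuous ellipsoid cover `Ξ`: for each `t` the map `x ↦ N_{x,t}` is continuous, and
there is `C > 0` with `(1/C) ξ_{x,t} ⊆ θ_{x,t} ⊆ C ξ_{x,t}` for all `x, t`, where dilation
of an ellipsoid is about its center. -/
theorem stmt2 (n : ℕ) (Θ : EllipsoidCover n) :
    ∃ Ξ : EllipsoidCover n,
      (∀ t : ℝ, Continuous fun x : Euc n => (Ξ.M x t : Euc n →L[ℝ] Euc n)) ∧
      ∃ C : ℝ, 0 < C ∧ ∀ (x : Euc n) (t : ℝ),
        Ξ.dil x t (1 / C) ⊆ Θ.θ x t ∧ Θ.θ x t ⊆ Ξ.dil x t C := by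
  have := Θ.nontrivial_space
  obtain ⟨N, hNc, hN⟩ := Θ.exists_continuous_comparable
  have ha₅ := Θ.ha₅
  obtain ⟨Ξ, rfl⟩ := Θ.exists_cover_of_comparable N (C := Θ.a₅ ^ 2) (by positivity)
    (fun x t => (hN x t).1) fun x t => (hN x t).2
  have hC : (0 : ℝ) < max 1 (Θ.a₅ ^ 2) := lt_max_of_lt_left one_pos
  refine ⟨Ξ, hNc, max 1 (Θ.a₅ ^ 2), hC, fun x t => ⟨?_, ?_⟩⟩
  · refine Subset.trans ?_ (EllipsoidCover.image_ball_subset (hN x t).1 x)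
    rintro _ ⟨v, hv, rfl⟩
    refine ⟨(1 / max 1 (Θ.a₅ ^ 2)) • v, ?_, by simp⟩
    rw [mem_ball_zero_iff] at hv ⊢
    rw [norm_smul, Real.norm_of_nonneg (by positivity)]
    exact (mul_le_of_le_one_left (norm_nonneg _)
      ((div_le_one hC).2 (le_max_left _ _))).trans_lt hv
  · exact EllipsoidCover.image_ball_subset_dilate hC ((hN x t).2.trans (le_max_right _ _)) x
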